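/- Let u : ℂ → ℝ be a smooth solution of the sinh-Gordon equation ∂∂̄u + (1/2) sinh(2u) = 0 and let c ∈ ℝ be a constant. Define ω̂ : ℂ → ℂ by ω̂(z) = c(z·∂u(z) − 1/2) + c(z̄·∂̄u(z) − 1/2). Then ω̂ solves the inhomogeneous Jacobi equation ∂̄∂ω̂ + cosh(2u)·ω̂ = −c·e^{2u} identically on ℂ. -/

import Mathlib

noncomputable section

open Complex Matrix

/-- Wirtinger derivative `∂f = (1/2)(f_x - i f_y)`. -/
def wd (f : ℂ → ℂ) (z : ℂ) : ℂ :=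
  (fderiv ℝ f z 1 - Complex.I * fderiv ℝ f z Complex.I) / 2

/-- Conjugate Wirtinger derivative `∂̄f = (1/2)(f_x + i f_y)`. -/
def wdb (f : ℂ → ℂ) (z : ℂ) : ℂ :=
  (fderiv ℝ f z 1 + Complex.I * fderiv ℝ f z Complex.I) / 2

/-- Complexification of a real-valued function. -/
def cx (u : ℂ → ℝ) : ℂ → ℂ := fun z => (u z : ℂ)

/-- Entrywise Wirtinger derivative of a matrix-valued function. -/
def mwd (F : ℂ → Matrix (Fin 2) (Fin 2) ℂ) (z : ℂ) : Matrix (Fin 2) (Fin 2) ℂ :=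
  Matrix.of fun i j => wd (fun w => F w i j) z

/-- Entrywise conjugate Wirtinger derivative of a matrix-valued function. -/
def mwdb (F : ℂ → Matrix (Fin 2) (Fin 2) ℂ) (z : ℂ) : Matrix (Fin 2) (Fin 2) ℂ :=
  Matrix.of fun i j => wdb (fun w => F w i j) z

/-- Entrywise Wirtinger derivative of a vector-valued function. -/
def vwd (v : ℂ → Fin 2 → ℂ) (z : ℂ) : Fin 2 → ℂ := fun i => wd (fun w => v w i) z

/-- Entrywise conjugate Wirtinger derivative of a vector-valued function. -/
def vwdb (v : ℂ → Fin 2 → ℂ) (z : ℂ) : Fin 2 → ℂ := fun i => wdb (fun w => v w i) z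

/-- `u` solves the sinh-Gordon equation `∂∂̄u + (1/2) sinh (2u) = 0`. -/
def SinhGordon (u : ℂ → ℝ) : Prop :=
  ∀ z, wd (wdb (cx u)) z + (1/2) * Complex.sinh (2 * (u z : ℂ)) = 0

/-- `(ψ₁, ψ₂)` solves the system `(Ψ_λ)`. -/
def SolPsi (u : ℂ → ℝ) (lam : ℂ) (p1 p2 : ℂ → ℂ) : Prop :=
  ContDiff ℝ (⊤ : ℕ∞) p1 ∧ ContDiff ℝ (⊤ : ℕ∞) p2 ∧
  (∀ z, wd p1 z = (1/2) * (wd (cx u) z * p1 z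
      + Complex.I * Complex.exp (-(u z : ℂ)) * p2 z)) ∧
  (∀ z, wd p2 z = (1/2) * (Complex.I * lam⁻¹ * Complex.exp ((u z : ℂ)) * p1 z
      - wd (cx u) z * p2 z)) ∧
  (∀ z, wdb p1 z = (1/2) * (-(wdb (cx u) z) * p1 z
      + Complex.I * lam * Complex.exp ((u z : ℂ)) * p2 z)) ∧
  (∀ z, wdb p2 z = (1/2) * (Complex.I * Complex.exp (-(u z : ℂ)) * p1 z
      + wdb (cx u) z * p2 z))

/-- `(φ₁, φ₂)` solves the system `(Φ_λ)`. -/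
def SolPhi (u : ℂ → ℝ) (lam : ℂ) (f1 f2 : ℂ → ℂ) : Prop :=
  ContDiff ℝ (⊤ : ℕ∞) f1 ∧ ContDiff ℝ (⊤ : ℕ∞) f2 ∧
  (∀ z, wd f1 z = -(1/2) * (wd (cx u) z * f1 z
      + Complex.I * lam⁻¹ * Complex.exp ((u z : ℂ)) * f2 z)) ∧
  (∀ z, wd f2 z = -(1/2) * (Complex.I * Complex.exp (-(u z : ℂ)) * f1 z
      - wd (cx u) z * f2 z)) ∧
  (∀ z, wdb f1 z = -(1/2) * (-(wdb (cx u) z) * f1 z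
      + Complex.I * Complex.exp (-(u z : ℂ)) * f2 z)) ∧
  (∀ z, wdb f2 z = -(1/2) * (Complex.I * lam * Complex.exp ((u z : ℂ)) * f1 z
      + wdb (cx u) z * f2 z))

/-- The matrix `A_λ = (1/2) [[∂u, iλ⁻¹e^u], [ie^{-u}, -∂u]]`. -/
def matA (u : ℂ → ℝ) (lam : ℂ) (z : ℂ) : Matrix (Fin 2) (Fin 2) ℂ :=
  ((1:ℂ)/2) • !![wd (cx u) z, Complex.I * lam⁻¹ * Complex.exp ((u z : ℂ));
    Complex.I * Complex.exp (-(u z : ℂ)), -(wd (cx u) z)]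

/-- The matrix `B_λ = (1/2) [[-∂̄u, ie^{-u}], [iλe^u, ∂̄u]]`. -/
def matB (u : ℂ → ℝ) (lam : ℂ) (z : ℂ) : Matrix (Fin 2) (Fin 2) ℂ :=
  ((1:ℂ)/2) • !![-(wdb (cx u) z), Complex.I * Complex.exp (-(u z : ℂ));
    Complex.I * lam * Complex.exp ((u z : ℂ)), wdb (cx u) z]

/-- Real-smooth functions `ℂ → ℂ` have smooth directional derivatives. -/
lemma contDiff_fderiv_apply {f : ℂ → ℂ} (hf : ContDiff ℝ (⊤ : ℕ∞) f) (v : ℂ) :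
    ContDiff ℝ (⊤ : ℕ∞) (fun z => fderiv ℝ f z v) :=
  (hf.fderiv_right (m := (⊤ : ℕ∞)) (by simp)).clm_apply contDiff_const

lemma contDiff_wd {f : ℂ → ℂ} (hf : ContDiff ℝ (⊤ : ℕ∞) f) :
    ContDiff ℝ (⊤ : ℕ∞) (wd f) :=
  ((contDiff_fderiv_apply hf 1).sub
    (contDiff_const.mul (contDiff_fderiv_apply hf Complex.I))).div_const 2

lemma contDiff_wdb {f : ℂ → ℂ} (hf : ContDiff ℝ (⊤ : ℕ∞) f) :
    ContDiff ℝ (⊤ : ℕ∞) (wdb f) :=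
  ((contDiff_fderiv_apply hf 1).add
    (contDiff_const.mul (contDiff_fderiv_apply hf Complex.I))).div_const 2

lemma ContDiff.differentiableAt_smooth {f : ℂ → ℂ} (hf : ContDiff ℝ (⊤ : ℕ∞) f) (z : ℂ) :
    DifferentiableAt ℝ f z :=
  hf.differentiable (by simp) z

section Rules

variable {f g : ℂ → ℂ} {z : ℂ}

lemma wd_add (hf : DifferentiableAt ℝ f z) (hg : DifferentiableAt ℝ g z) :
    wd (fun w => f w + g w) z = wd f z + wd g z := by
  simp only [wd, fderiv_fun_add hf hg, _root_.add_apply]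
  ring

lemma wdb_add (hf : DifferentiableAt ℝ f z) (hg : DifferentiableAt ℝ g z) :
    wdb (fun w => f w + g w) z = wdb f z + wdb g z := by
  simp only [wdb, fderiv_fun_add hf hg, _root_.add_apply]
  ring

lemma wd_sub_const (a : ℂ) : wd (fun w => f w - a) z = wd f z := by
  simp only [wd, fderiv_sub_const]

lemma wd_mul (hf : DifferentiableAt ℝ f z) (hg : DifferentiableAt ℝ g z) :
    wd (fun w => f w * g w) z = f z * wd g z + g z * wd f z := by
  simp only [wd, fderiv_fun_mul hf hg, _root_.add_apply, _root_.smul_apply,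
    smul_eq_mul]
  ring

lemma wdb_mul (hf : DifferentiableAt ℝ f z) (hg : DifferentiableAt ℝ g z) :
    wdb (fun w => f w * g w) z = f z * wdb g z + g z * wdb f z := by
  simp only [wdb, fderiv_fun_mul hf hg, _root_.add_apply, _root_.smul_apply,
    smul_eq_mul]
  ring

lemma wd_const_mul (a : ℂ) (hf : DifferentiableAt ℝ f z) :
    wd (fun w => a * f w) z = a * wd f z := by
  simp only [wd, fderiv_const_mul hf, _root_.smul_apply, smul_eq_mul]
  ring

lemma wdb_const_mul (a : ℂ) (hf : DifferentiableAt ℝ f z) :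
    wdb (fun w => a * f w) z = a * wdb f z := by
  simp only [wdb, fderiv_const_mul hf, _root_.smul_apply, smul_eq_mul]
  ring

lemma wd_id : wd (fun w => w) z = 1 := by
  simp [wd]

lemma wdb_id : wdb (fun w => w) z = 0 := by
  simp [wdb]

lemma hasFDerivAt_starRingEnd :
    HasFDerivAt (fun w : ℂ => (starRingEnd ℂ) w) (Complex.conjCLE : ℂ →L[ℝ] ℂ) z :=
  Complex.conjCLE.hasFDerivAt

lemma wd_conj : wd (fun w => (starRingEnd ℂ) w) z = 0 := by
  simp [wd, hasFDerivAt_starRingEnd.fderiv]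

lemma wdb_conj : wdb (fun w => (starRingEnd ℂ) w) z = 1 := by
  simp [wdb, hasFDerivAt_starRingEnd.fderiv]

/-- Chain rule for postcomposition with a holomorphic function. -/
lemma fderiv_holomorphic_comp {h : ℂ → ℂ} {h' : ℂ} (hh : HasDerivAt h h' (f z))
    (hf : DifferentiableAt ℝ f z) (v : ℂ) :
    fderiv ℝ (fun w => h (f w)) z v = h' * fderiv ℝ f z v := by
  have := (hh.complexToReal_fderiv.comp z hf.hasFDerivAt).fderiv
  simp only [Function.comp_def] at this
  simp [this]

lemma wd_holomorphic_comp {h : ℂ → ℂ} {h' : ℂ} (hh : HasDerivAt h h' (f z))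
    (hf : DifferentiableAt ℝ f z) : wd (fun w => h (f w)) z = h' * wd f z := by
  simp only [wd, fderiv_holomorphic_comp hh hf]
  ring

lemma wdb_holomorphic_comp {h : ℂ → ℂ} {h' : ℂ} (hh : HasDerivAt h h' (f z))
    (hf : DifferentiableAt ℝ f z) : wdb (fun w => h (f w)) z = h' * wdb f z := by
  simp only [wdb, fderiv_holomorphic_comp hh hf]
  ring

end Rules

lemma fderiv_fderiv_apply_comm {f : ℂ → ℂ} (hf : ContDiff ℝ (⊤ : ℕ∞) f) (z v w : ℂ) :
    fderiv ℝ (fun x => fderiv ℝ f x v) z w = fderiv ℝ (fun x => fderiv ℝ f x w) z v := by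
  have hd : DifferentiableAt ℝ (fderiv ℝ f) z :=
    (hf.fderiv_right (m := (⊤ : ℕ∞)) (by simp)).differentiable (by simp) z
  have hs : IsSymmSndFDerivAt ℝ f z :=
    hf.contDiffAt.isSymmSndFDerivAt (by simpa using WithTop.coe_le_coe.2 (le_top : (2 : ℕ∞) ≤ ⊤))
  simpa [fderiv_clm_apply hd (differentiableAt_const _)] using hs w v

/-- The Wirtinger derivatives commute on smooth functions. -/
lemma wdb_wd_comm {f : ℂ → ℂ} (hf : ContDiff ℝ (⊤ : ℕ∞) f) (z : ℂ) :
    wdb (wd f) z = wd (wdb f) z := by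
  have h1 := (contDiff_fderiv_apply hf 1).differentiableAt_smooth z
  have hI := (contDiff_fderiv_apply hf Complex.I).differentiableAt_smooth z
  have hwd : ∀ v, fderiv ℝ (wd f) z v = (fderiv ℝ (fun x => fderiv ℝ f x 1) z v
      - Complex.I * fderiv ℝ (fun x => fderiv ℝ f x Complex.I) z v) / 2 := fun v => by
    have e : wd f = fun x => (fderiv ℝ f x 1 - Complex.I * fderiv ℝ f x Complex.I) * 2⁻¹ := by
      funext x
      simp [wd, div_eq_mul_inv]
    rw [e, fderiv_mul_const (h1.fun_sub (hI.const_mul _)),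
      fderiv_fun_sub h1 (hI.const_mul _), fderiv_const_mul hI]
    simp only [_root_.smul_apply, _root_.sub_apply, smul_eq_mul]
    ring
  have hwdb : ∀ v, fderiv ℝ (wdb f) z v = (fderiv ℝ (fun x => fderiv ℝ f x 1) z v
      + Complex.I * fderiv ℝ (fun x => fderiv ℝ f x Complex.I) z v) / 2 := fun v => by
    have e : wdb f = fun x => (fderiv ℝ f x 1 + Complex.I * fderiv ℝ f x Complex.I) * 2⁻¹ := by
      funext x
      simp [wdb, div_eq_mul_inv]
    rw [e, fderiv_mul_const (h1.fun_add (hI.const_mul _)),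
      fderiv_fun_add h1 (hI.const_mul _), fderiv_const_mul hI]
    simp only [_root_.smul_apply, _root_.add_apply, smul_eq_mul]
    ring
  rw [wdb, wd, hwd, hwd, hwdb, hwdb, fderiv_fderiv_apply_comm hf z 1 Complex.I]
  ring

/-- the inhomogeneous Jacobi field
`ω̂ = c(z∂u - 1/2) + c(z̄∂̄u - 1/2)`. -/
theorem statement19 (u : ℂ → ℝ) (hu : ContDiff ℝ (⊤ : ℕ∞) u) (hsg : SinhGordon u) (c : ℝ) :
    ∀ z, wdb (wd (fun w => (c : ℂ) * (w * wd (cx u) w - 1/2)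
          + (c : ℂ) * ((starRingEnd ℂ) w * wdb (cx u) w - 1/2))) z
        + Complex.cosh (2 * (u z : ℂ)) * ((c : ℂ) * (z * wd (cx u) z - 1/2)
          + (c : ℂ) * ((starRingEnd ℂ) z * wdb (cx u) z - 1/2))
      = -(c : ℂ) * Complex.exp (2 * (u z : ℂ)) := by
  intro z
  have hU : ContDiff ℝ (⊤ : ℕ∞) (cx u) := Complex.ofRealCLM.contDiff.comp hu
  have hP := contDiff_wd hU
  have hQ := contDiff_wdb hU
  have hPP := contDiff_wd hP
  have hid : ContDiff ℝ (⊤ : ℕ∞) (fun w : ℂ => w) := contDiff_id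
  have hconj : ContDiff ℝ (⊤ : ℕ∞) (fun w : ℂ => (starRingEnd ℂ) w) :=
    Complex.conjCLE.contDiff
  have hSQ : wd (wdb (cx u)) = fun w => -(1/2) * Complex.sinh (2 * cx u w) := by
    funext w
    linear_combination (norm := (simp only [cx]; ring)) hsg w
  have hSP : wdb (wd (cx u)) = fun w => -(1/2) * Complex.sinh (2 * cx u w) := by
    rw [← hSQ]
    exact funext (wdb_wd_comm hU)
  have hder : ∀ a : ℂ, HasDerivAt (fun s : ℂ => -(1/2) * Complex.sinh (2 * s))
      (-Complex.cosh (2 * a)) a := fun a => by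
    have h := (((hasDerivAt_id' a).const_mul (2 : ℂ)).csinh).const_mul (-(1/2) : ℂ)
    exact h.congr_deriv (by ring)
  have hS : ContDiff ℝ (⊤ : ℕ∞) (fun w => -(1/2) * Complex.sinh (2 * cx u w)) :=
    hSQ ▸ contDiff_wd hQ
  have hwd : wd (fun w => (c : ℂ) * (w * wd (cx u) w - 1/2)
          + (c : ℂ) * ((starRingEnd ℂ) w * wdb (cx u) w - 1/2))
      = fun w => (c : ℂ) * ((w * wd (wd (cx u)) w + wd (cx u) w)
          + (starRingEnd ℂ) w * (-(1/2) * Complex.sinh (2 * cx u w))) := by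
    funext w
    have d1 := (hid.mul hP).differentiableAt_smooth w
    have d2 := (hconj.mul hQ).differentiableAt_smooth w
    rw [wd_add ((d1.sub_const _).const_mul _) ((d2.sub_const _).const_mul _),
      wd_const_mul _ (d1.sub_const _), wd_const_mul _ (d2.sub_const _), wd_sub_const,
      wd_sub_const, wd_mul (hid.differentiableAt_smooth w) (hP.differentiableAt_smooth w),
      wd_mul (hconj.differentiableAt_smooth w) (hQ.differentiableAt_smooth w), wd_id, wd_conj,
      hSQ]
    ring
  have hU' := hU.differentiableAt_smooth z
  have e1 := (hid.mul hPP).differentiableAt_smooth z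
  have e2 := hP.differentiableAt_smooth z
  have e3 := (hconj.mul hS).differentiableAt_smooth z
  rw [hwd, wdb_const_mul _ ((e1.fun_add e2).fun_add e3), wdb_add (e1.fun_add e2) e3, wdb_add e1 e2,
    wdb_mul (hid.differentiableAt_smooth z) (hPP.differentiableAt_smooth z),
    wdb_mul (hconj.differentiableAt_smooth z) (hS.differentiableAt_smooth z),
    wdb_id, wdb_conj, wdb_wd_comm hP, hSP, wd_holomorphic_comp (hder _) hU',
    wdb_holomorphic_comp (hder _) hU', ← Complex.cosh_add_sinh]
  simp only [cx]
  ring
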